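/- For every real number u with 0 ≤ u < 1, the hypergeometric series Σ_{n≥0} [(−2/3)ₙ (−1/3)ₙ / ((−1/2)ₙ n!)] · uⁿ equals (√u/3)·sin((1/3)·arcsin(√u)) + √(1−u)·cos((1/3)·arcsin(√u)). -/

import Mathlib

/-- The rising Pochhammer symbol `(a)ₙ = a(a+1)⋯(a+n−1)`. -/
noncomputable def poch (a : ℝ) (n : ℕ) : ℝ := ∏ i ∈ Finset.range n, (a + i)

def PB (a : ℕ → ℝ) : Prop := ∃ C : ℝ, ∃ k : ℕ, 0 ≤ C ∧ ∀ n, |a n| ≤ C * ((n:ℝ) + 1) ^ k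

def DD (a : ℕ → ℝ) : ℕ → ℝ := fun n => ((n:ℝ) + 1) * a (n + 1)

noncomputable def PP (a : ℕ → ℝ) (x : ℝ) : ℝ := ∑' n, a n * x ^ n

theorem PB.dd {a : ℕ → ℝ} (h : PB a) : PB (DD a) := by
  obtain ⟨C, k, hC, h⟩ := h
  refine ⟨C * 2 ^ k, k + 1, by positivity, fun n => ?_⟩
  unfold DD
  rw [abs_mul, abs_of_nonneg (by positivity : (0:ℝ) ≤ (n:ℝ) + 1)]
  have h1 := h (n + 1)
  push_cast at h1
  have h2 : ((n:ℝ) + 1 + 1) ^ k ≤ (2 * ((n:ℝ) + 1)) ^ k := by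
    apply pow_le_pow_left₀ (by positivity)
    have : (0:ℝ) ≤ n := by positivity
    linarith
  rw [mul_pow] at h2
  calc ((n:ℝ) + 1) * |a (n + 1)| ≤ ((n:ℝ) + 1) * (C * (2 ^ k * ((n:ℝ) + 1) ^ k)) := by gcongr; exact h1.trans (by gcongr)
    _ = _ := by ring

theorem PB.summable_abs {a : ℕ → ℝ} (h : PB a) {x : ℝ} (hx : |x| < 1) :
    Summable (fun n => |a n| * |x| ^ n) := by
  obtain ⟨C, k, hC, h⟩ := h
  have key0 : Summable (fun n : ℕ => ((n:ℝ) ^ k * |x| ^ n)) :=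
    summable_pow_mul_geometric_of_norm_lt_one k (by rw [Real.norm_eq_abs, abs_abs]; exact hx)
  have key2 : Summable (fun n : ℕ => (((n + 1 : ℕ):ℝ) ^ k * |x| ^ (n + 1))) :=
    (summable_nat_add_iff (f := fun n : ℕ => ((n:ℝ) ^ k * |x| ^ n)) 1).2 key0
  have key3 := key2.mul_left (C * 2 ^ k)
  have main : Summable (fun n : ℕ => |a (n + 1)| * |x| ^ (n + 1)) := by
    refine Summable.of_nonneg_of_le (fun n => by positivity) (fun n => ?_) key3
    have h1 := h (n + 1)
    push_cast at h1 ⊢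
    have h2 : ((n:ℝ) + 1 + 1) ^ k ≤ (2 * ((n:ℝ) + 1)) ^ k := by
      apply pow_le_pow_left₀ (by positivity)
      have : (0:ℝ) ≤ n := by positivity
      linarith
    rw [mul_pow] at h2
    have h3 : |a (n + 1)| ≤ C * (2 ^ k * ((n:ℝ) + 1) ^ k) :=
      h1.trans (mul_le_mul_of_nonneg_left h2 hC)
    have h4 := mul_le_mul_of_nonneg_right h3 (by positivity : 0 ≤ |x| ^ (n + 1))
    linarith
  exact (summable_nat_add_iff (f := fun n : ℕ => |a n| * |x| ^ n) 1).1 main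

theorem PB.hasSum {a : ℕ → ℝ} (h : PB a) {x : ℝ} (hx : |x| < 1) :
    HasSum (fun n => a n * x ^ n) (PP a x) := by
  apply Summable.hasSum
  apply Summable.of_norm
  simpa [abs_mul, abs_pow] using h.summable_abs hx

theorem _root_.HasSum.congr_fn {f g : ℕ → ℝ} {s : ℝ} (h : HasSum f s) (e : ∀ n, g n = f n) :
    HasSum g s := by
  have : g = f := funext e
  rw [this]; exact h

theorem hasSum_shift {a b : ℕ → ℝ} {x s : ℝ} (h : HasSum (fun n => a n * x ^ n) s)
    (hb0 : b 0 = 0) (hb : ∀ n, b (n + 1) = a n) : HasSum (fun n => b n * x ^ n) (x * s) := by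
  have := (hasSum_nat_add_iff' (f := fun n => b n * x ^ n) (g := x * s) 1).1
  apply this
  simp only [Finset.sum_range_one, hb0, zero_mul, sub_zero, hb]
  refine (h.mul_left x).congr_fn fun n => ?_
  ring

theorem PB.hasDerivAt {a : ℕ → ℝ} (h : PB a) {x : ℝ} (hx : |x| < 1) :
    HasDerivAt (PP a) (PP (DD a) x) x := by
  obtain ⟨r, hr, hr1⟩ := exists_between hx
  have hr0 : 0 ≤ r := (abs_nonneg x).trans hr.le
  have hra : |r| = r := abs_of_nonneg hr0
  have hs : Summable (fun n : ℕ => |a n| * (n * r ^ (n - 1))) := by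
    apply (summable_nat_add_iff (f := fun n : ℕ => |a n| * (n * r ^ (n - 1))) 1).1
    have := h.dd.summable_abs (x := r) (by rwa [hra])
    refine this.congr fun n => ?_
    unfold DD
    rw [abs_mul, abs_of_nonneg (by positivity : (0:ℝ) ≤ (n:ℝ) + 1), hra]
    push_cast
    ring
  have hd := hasDerivAt_tsum_of_isPreconnected (𝕜 := ℝ) (F := ℝ)
    (g := fun n x => a n * x ^ n) (g' := fun n x => a n * (n * x ^ (n - 1)))
    (t := Metric.ball (0:ℝ) r) (y₀ := 0) (y := x) hs Metric.isOpen_ball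
    (convex_ball _ _).isPreconnected
    (fun n y _ => (hasDerivAt_pow n y).const_mul (a n))
    (fun n y hy => by
      have hy' : |y| ≤ r := by
        have := Metric.mem_ball.1 hy
        rw [dist_zero_right] at this
        exact this.le
      rw [Real.norm_eq_abs, abs_mul, abs_mul, abs_pow, Nat.abs_cast]
      gcongr)
    (Metric.mem_ball_self (by have := abs_nonneg x; linarith))
    (h.hasSum (x := 0) (by simp)).summable
    (by simpa using hr)
  have hsum : HasSum (fun n : ℕ => a n * (n * x ^ (n - 1))) (PP (DD a) x) := by
    apply (hasSum_nat_add_iff' (f := fun n : ℕ => a n * (n * x ^ (n - 1))) 1).1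
    simp only [Finset.sum_range_one, Nat.cast_zero, zero_mul, mul_zero, sub_zero]
    refine (h.dd.hasSum hx).congr_fn fun n => ?_
    unfold DD
    simp only [Nat.add_sub_cancel]
    push_cast
    ring
  rw [hsum.tsum_eq] at hd
  exact hd

noncomputable def ff : ℕ → ℝ := fun n =>
  poch (-2 / 3) n * poch (-1 / 3) n / (poch (-1 / 2) n * n.factorial)

theorem poch_half_ne (n : ℕ) : poch (-1 / 2) n ≠ 0 := by
  unfold poch
  refine Finset.prod_ne_zero_iff.2 fun i _ hi => ?_
  have h1 : (2 * i : ℝ) = 1 := by linarith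
  have h2 : 2 * i = 1 := by exact_mod_cast h1
  omega

theorem half_ne (i : ℕ) : (-1 / 2 + (i:ℝ)) ≠ 0 := by
  intro hi
  have h1 : (2 * i : ℝ) = 1 := by linarith
  have h2 : 2 * i = 1 := by exact_mod_cast h1
  omega

theorem ff_succ (n : ℕ) : ((n:ℝ) + 1) * (n - 1 / 2) * ff (n + 1) = (n - 2 / 3) * (n - 1 / 3) * ff n := by
  have h1 := poch_half_ne n
  have h2 := half_ne n
  have h3 : (n.factorial : ℝ) ≠ 0 := by positivity
  have h4 : ((n:ℝ) + 1) ≠ 0 := by positivity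
  have e : ∀ a, poch a (n + 1) = poch a n * (a + n) := fun a => Finset.prod_range_succ _ _
  unfold ff
  rw [e, e, e, Nat.factorial_succ]
  push_cast
  have h5 : (n:ℝ) - 1 / 2 = (-1 / 2 + (n:ℝ)) := by ring
  rw [h5]
  generalize poch (-1 / 2) n = p at *
  rw [mul_div_assoc', div_eq_iff (by positivity)]
  field_simp
  ring

theorem ff_zero : ff 0 = 1 := by simp [ff, poch]

noncomputable def gg : ℕ → ℝ := fun n => -(9 / 4) * DD ff n

theorem gg_zero : gg 0 = 1 := by
  have := ff_succ 0
  rw [ff_zero] at this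
  norm_num at this
  simp only [gg, DD]
  norm_num
  linarith

theorem gg_succ (n : ℕ) :
    ((n:ℝ) + 1) * (n + 1 / 2) * gg (n + 1) = (n + 1 / 3) * (n + 2 / 3) * gg n := by
  have := ff_succ (n + 1)
  simp only [gg, DD]
  push_cast at this ⊢
  linear_combination (-(9 / 4) * ((n:ℝ) + 1)) * this

theorem gg_bd (n : ℕ) : 0 ≤ gg n ∧ gg n ≤ 1 := by
  induction n with
  | zero => simp [gg_zero]
  | succ n ih =>
    have h := gg_succ n
    have hn : (0:ℝ) ≤ n := by positivity
    have hp : 0 < ((n:ℝ) + 1) * (n + 1 / 2) := by positivity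
    have e : gg (n + 1) = (n + 1 / 3) * (n + 2 / 3) * gg n / (((n:ℝ) + 1) * (n + 1 / 2)) := by
      rw [eq_div_iff hp.ne']; linarith
    rw [e]
    refine ⟨by have := ih.1; positivity, ?_⟩
    rw [div_le_one hp]
    calc ((n:ℝ) + 1 / 3) * (n + 2 / 3) * gg n ≤ (n + 1 / 3) * (n + 2 / 3) * 1 := by
          gcongr; exact ih.2
      _ ≤ _ := by nlinarith

theorem gg_PB : PB gg := ⟨1, 0, by norm_num, fun n => by
  rw [abs_of_nonneg (gg_bd n).1]; simpa using (gg_bd n).2⟩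

theorem ff_PB : PB ff := by
  refine ⟨1, 0, by norm_num, fun n => ?_⟩
  rcases n with _ | n
  · simp [ff_zero]
  · have h := gg_bd n
    have hn : (0:ℝ) ≤ n := by positivity
    simp only [gg, DD] at h
    rw [pow_zero, mul_one, abs_le]
    constructor <;> nlinarith [h.1, h.2]

theorem gg_ode {x : ℝ} (hx : |x| < 1) :
    x * (1 - x) * PP (DD (DD gg)) x + (1 / 2 - 2 * x) * PP (DD gg) x - 2 / 9 * PP gg x = 0 := by
  have h0 := gg_PB.hasSum hx
  have h1 := gg_PB.dd.hasSum hx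
  have h2 := gg_PB.dd.dd.hasSum hx
  have h1x := hasSum_shift (b := fun n => n * gg n) h1 (by simp) (fun n => by simp [DD])
  have h2x := hasSum_shift (b := fun n => n * DD gg n) h2 (by simp)
    (fun n => by simp [DD])
  have h2xx := hasSum_shift (b := fun n => n * ((n:ℝ) - 1) * gg n) h2x (by simp)
    (fun n => by simp [DD]; ring)
  have hz := (((h2x.sub h2xx).add (h1.mul_left (1 / 2))).sub (h1x.mul_left 2)).sub
    (h0.mul_left (2 / 9))
  have hz0 := hz.unique (by
    refine (hasSum_zero : HasSum (fun _ : ℕ => (0:ℝ)) 0).congr_fn fun n => ?_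
    have := gg_succ n
    simp only [DD]
    linear_combination (x ^ n) * this)
  linear_combination hz0

theorem PP_zero (a : ℕ → ℝ) : PP a 0 = a 0 := by
  unfold PP
  rw [tsum_eq_single 0]
  · simp
  · intro n hn; simp [hn]

theorem sin_sq_lt {t : ℝ} (ht : t ∈ Set.Ioo (-(Real.pi / 2)) (Real.pi / 2)) :
    |Real.sin t ^ 2| < 1 := by
  rw [abs_of_nonneg (sq_nonneg _)]
  have := Real.cos_pos_of_mem_Ioo ht
  nlinarith [Real.sin_sq_add_cos_sq t]

theorem const_of_deriv {f f' : ℝ → ℝ}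
    (h : ∀ t ∈ Set.Ioo (-(Real.pi / 2)) (Real.pi / 2), HasDerivAt f (f' t) t)
    (h0 : ∀ t ∈ Set.Ioo (-(Real.pi / 2)) (Real.pi / 2), f' t = 0)
    {t : ℝ} (ht : t ∈ Set.Ioo (-(Real.pi / 2)) (Real.pi / 2)) : f t = f 0 := by
  have hp := Real.pi_pos
  refine isOpen_Ioo.is_const_of_deriv_eq_zero (isPreconnected_Ioo) (s := Set.Ioo (-(Real.pi / 2)) (Real.pi / 2))
    (fun y hy => (h y hy).differentiableAt.differentiableWithinAt)
    (fun y hy => ?_) ht ⟨by linarith, by linarith⟩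
  rw [(h y hy).deriv, h0 y hy]; rfl

theorem comp_sin {a : ℕ → ℝ} (h : PB a) {t : ℝ}
    (ht : t ∈ Set.Ioo (-(Real.pi / 2)) (Real.pi / 2)) :
    HasDerivAt (fun t => PP a (Real.sin t ^ 2))
      (PP (DD a) (Real.sin t ^ 2) * (2 * Real.sin t * Real.cos t)) t := by
  have h1 : HasDerivAt (fun t => Real.sin t ^ 2) (2 * Real.sin t * Real.cos t) t := by
    exact ((Real.hasDerivAt_sin t).pow 2).congr_deriv (by simp)
  exact (h.hasDerivAt (sin_sq_lt ht)).comp t h1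

theorem third_sin (t : ℝ) : HasDerivAt (fun t => Real.sin (1 / 3 * t)) (Real.cos (1 / 3 * t) * (1 / 3)) t := by
  simpa using ((hasDerivAt_id t).const_mul (1 / 3 : ℝ)).sin
theorem third_cos (t : ℝ) : HasDerivAt (fun t => Real.cos (1 / 3 * t)) (-Real.sin (1 / 3 * t) * (1 / 3)) t := by
  simpa using ((hasDerivAt_id t).const_mul (1 / 3 : ℝ)).cos

theorem gg_eq {t : ℝ} (ht : t ∈ Set.Ioo (-(Real.pi / 2)) (Real.pi / 2)) :
    PP gg (Real.sin t ^ 2) * Real.cos t = Real.cos (1 / 3 * t) := by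
  set y : ℝ → ℝ := fun t => PP gg (Real.sin t ^ 2) * Real.cos t with hy
  set z : ℝ → ℝ := fun t => 2 * (PP (DD gg) (Real.sin t ^ 2) * (Real.sin t * Real.cos t ^ 2))
    - PP gg (Real.sin t ^ 2) * Real.sin t with hz
  have dy : ∀ t ∈ Set.Ioo (-(Real.pi / 2)) (Real.pi / 2), HasDerivAt y (z t) t := by
    intro t ht
    refine ((comp_sin gg_PB ht).mul (Real.hasDerivAt_cos t)).congr_deriv ?_
    simp only [hz]; ring
  have dz : ∀ t ∈ Set.Ioo (-(Real.pi / 2)) (Real.pi / 2), HasDerivAt z (-(1 / 9) * y t) t := by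
    intro t ht
    have hc : HasDerivAt (fun t => Real.cos t ^ 2) (2 * Real.cos t * (-Real.sin t)) t := by
      exact ((Real.hasDerivAt_cos t).pow 2).congr_deriv (by simp)
    refine ((((comp_sin gg_PB.dd ht).mul ((Real.hasDerivAt_sin t).mul hc)).const_mul 2).sub
      ((comp_sin gg_PB ht).mul (Real.hasDerivAt_sin t))).congr_deriv ?_
    have ho := gg_ode (sin_sq_lt ht)
    have hs := Real.sin_sq_add_cos_sq t
    have hs' : Real.cos t ^ 2 = 1 - Real.sin t ^ 2 := by linarith
    simp only [hy, Pi.mul_apply]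
    linear_combination (4 * Real.cos t) * ho + (4 * PP (DD (DD gg)) (Real.sin t ^ 2) * Real.sin t ^ 2 * Real.cos t + 2 * PP (DD gg) (Real.sin t ^ 2) * Real.cos t) * hs'
  have hA := const_of_deriv (f := fun t => y t * Real.cos (1 / 3 * t) - 3 * (z t * Real.sin (1 / 3 * t)))
    (fun t ht => ((dy t ht).mul (third_cos t)).sub (((dz t ht).mul (third_sin t)).const_mul 3))
    (fun t ht => by ring) ht
  have hB := const_of_deriv (f := fun t => y t * Real.sin (1 / 3 * t) + 3 * (z t * Real.cos (1 / 3 * t)))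
    (fun t ht => ((dy t ht).mul (third_sin t)).add (((dz t ht).mul (third_cos t)).const_mul 3))
    (fun t ht => by ring) ht
  have y0 : y 0 = 1 := by simp [hy, PP_zero, gg_zero]
  have z0 : z 0 = 0 := by simp [hz]
  simp only [y0, z0, mul_zero, Real.sin_zero, Real.cos_zero] at hA hB
  have hs := Real.sin_sq_add_cos_sq (1 / 3 * t)
  change y t = _
  linear_combination Real.cos (1 / 3 * t) * hA + Real.sin (1 / 3 * t) * hB - y t * hs

theorem PP_DD_ff (x : ℝ) : PP (DD ff) x = -(4 / 9) * PP gg x := by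
  unfold PP
  rw [← tsum_mul_left]
  congr 1; ext n
  simp only [gg]; ring

theorem ff_eq {t : ℝ} (ht : t ∈ Set.Ioo (-(Real.pi / 2)) (Real.pi / 2)) :
    PP ff (Real.sin t ^ 2) = Real.sin t / 3 * Real.sin (1 / 3 * t) + Real.cos t * Real.cos (1 / 3 * t) := by
  have h := const_of_deriv (f := fun t => PP ff (Real.sin t ^ 2) -
      (Real.sin t / 3 * Real.sin (1 / 3 * t) + Real.cos t * Real.cos (1 / 3 * t)))
    (fun t ht => (comp_sin ff_PB ht).sub ((((Real.hasDerivAt_sin t).div_const 3).mul (third_sin t)).add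
      ((Real.hasDerivAt_cos t).mul (third_cos t))))
    (fun t ht => by
      have := gg_eq ht
      rw [PP_DD_ff]
      linear_combination (-(8 / 9) * Real.sin t) * this) ht
  simp [PP_zero, ff_zero] at h
  simp only [one_div]
  linarith

theorem stmt_6 (u : ℝ) (hu0 : 0 ≤ u) (hu1 : u < 1) :
    HasSum
      (fun n : ℕ =>
        poch (-2 / 3) n * poch (-1 / 3) n / (poch (-1 / 2) n * n.factorial) * u ^ n)
      (Real.sqrt u / 3 * Real.sin ((1 / 3) * Real.arcsin (Real.sqrt u)) +
        Real.sqrt (1 - u) * Real.cos ((1 / 3) * Real.arcsin (Real.sqrt u))) := by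
  have h := ff_PB.hasSum (x := u) (by rwa [abs_of_nonneg hu0])
  have hs0 := Real.sqrt_nonneg u
  have hs1 : Real.sqrt u < 1 := by
    rw [Real.sqrt_lt' one_pos]; simpa using hu1
  have ht : Real.arcsin (Real.sqrt u) ∈ Set.Ioo (-(Real.pi / 2)) (Real.pi / 2) :=
    ⟨Real.neg_pi_div_two_lt_arcsin.2 (by linarith), Real.arcsin_lt_pi_div_two.2 hs1⟩
  have e := ff_eq ht
  rw [Real.cos_arcsin, Real.sin_arcsin (by linarith) hs1.le, Real.sq_sqrt hu0] at e
  rw [← e]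
  exact h
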